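/- Let X and X̃ be real random variables with laws P and P̃, cumulative distribution functions F and F̃, and right-continuous pseudo-inverses F^{-1}(u)=inf{x: F(x)>u}, F̃^{-1}(u)=inf{x: F̃(x)>u}. Assume F is continuous and set T(x)=F̃^{-1}(F(x)). Fix y>0 and assume there is a function φ_y∈L¹([0,1],ℝ₊) such that for all u∈(0,1), F(F^{-1}(u)+y)−u ≤ ∫₀ᵘ φ_y(v)dv. Then for every q>0 and δ∈[0,+∞] (with conventions 1/0=+∞ and 1/(+∞)=0), ∫_ℝ |T(x−y)|^q P(dx) ≤ E[|X̃|^q] + ‖|X̃|^q‖_{1+1/δ} · ‖φ_y(U)‖_{1+δ}, where U is uniform on [0,1]; both sides may be +∞, but the inequality always holds. -/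

import Mathlib

open MeasureTheory Set Filter ProbabilityTheory
open scoped ENNReal Topology

/-- The right-continuous pseudo-inverse of the cumulative distribution function of `μ`. -/
noncomputable def quantile (μ : Measure ℝ) (u : ℝ) : ℝ := sInf {x : ℝ | u < cdf μ x}

section Quantile

variable {μ : Measure ℝ} {u v c : ℝ}

lemma nonempty_setOf_lt_cdf (hu : u < 1) : {x : ℝ | u < cdf μ x}.Nonempty :=
  ((tendsto_cdf_atTop μ).eventually (lt_mem_nhds hu)).exists

lemma bddBelow_setOf_lt_cdf (hu : 0 < u) : BddBelow {x : ℝ | u < cdf μ x} := by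
  obtain ⟨a, ha⟩ := ((tendsto_cdf_atBot μ).eventually (gt_mem_nhds hu)).exists
  refine ⟨a, fun x hx => le_of_not_gt fun hxa => ?_⟩
  exact lt_asymm (lt_of_lt_of_le hx (monotone_cdf μ hxa.le)) ha

lemma monotoneOn_quantile : MonotoneOn (quantile μ) (Ioo 0 1) := fun _ hu _ hv huv =>
  csInf_le_csInf (bddBelow_setOf_lt_cdf hu.1) (nonempty_setOf_lt_cdf hv.2)
    fun _ hx => huv.trans_lt hx

lemma aemeasurable_quantile : AEMeasurable (quantile μ) (volume.restrict (Ioo 0 1)) :=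
  aemeasurable_restrict_of_monotoneOn measurableSet_Ioo monotoneOn_quantile

variable [IsProbabilityMeasure μ]

lemma measureReal_Iio_eq_leftLim_cdf (c : ℝ) : μ.real (Iio c) = Function.leftLim (cdf μ) c := by
  have h := (cdf μ).measure_Iio (tendsto_cdf_atBot μ) c
  rw [measure_cdf, sub_zero] at h
  rw [Measure.real, h, ENNReal.toReal_ofReal]
  exact (cdf_nonneg μ (c - 1)).trans ((monotone_cdf μ).le_leftLim (sub_one_lt c))

lemma le_quantile_iff (hu : u ∈ Ioo (0 : ℝ) 1) : c ≤ quantile μ u ↔ μ.real (Iio c) ≤ u := by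
  constructor
  · intro h
    rw [measureReal_Iio_eq_leftLim_cdf]
    refine le_of_tendsto ((monotone_cdf μ).tendsto_leftLim c) ?_
    filter_upwards [self_mem_nhdsWithin] with x hx
    by_contra! hlt
    exact (csInf_le (bddBelow_setOf_lt_cdf hu.1) hlt).not_gt (lt_of_lt_of_le hx h)
  · intro h
    refine le_csInf (nonempty_setOf_lt_cdf hu.2) fun b hb => le_of_not_gt fun hbc => ?_
    have : cdf μ b ≤ μ.real (Iio c) := by
      rw [cdf_eq_real]
      exact measureReal_mono (Iic_subset_Iio.2 hbc)
    exact (lt_of_lt_of_le hb (this.trans h)).false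

lemma map_quantile : (volume.restrict (Ioo 0 1)).map (quantile μ) = μ := by
  have : IsProbabilityMeasure ((volume : Measure ℝ).restrict (Ioo 0 1)) := ⟨by simp⟩
  have := Measure.isProbabilityMeasure_map (aemeasurable_quantile (μ := μ))
  refine Measure.ext_of_Ici _ _ fun c => ?_
  rw [Measure.map_apply_of_aemeasurable aemeasurable_quantile measurableSet_Ici,
    Measure.restrict_apply₀' measurableSet_Ioo.nullMeasurableSet]
  have hset : quantile μ ⁻¹' Ici c ∩ Ioo 0 1 = Ici (μ.real (Iio c)) ∩ Ioo 0 1 := by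
    ext u
    simp only [mem_inter_iff, mem_preimage, mem_Ici]
    exact and_congr_left fun hu => le_quantile_iff hu
  have hae : (Ici (μ.real (Iio c)) ∩ Ioo 0 1 : Set ℝ) =ᵐ[volume]
      (Ici (μ.real (Iio c)) ∩ Iic 1 : Set ℝ) := by
    have h0 : (Ici (μ.real (Iio c)) ∩ Icc 0 1 : Set ℝ) = Ici (μ.real (Iio c)) ∩ Iic 1 := by
      ext u
      simp only [mem_inter_iff, mem_Ici, mem_Icc, mem_Iic]
      exact ⟨fun h => ⟨h.1, h.2.2⟩, fun h => ⟨h.1, measureReal_nonneg.trans h.1, h.2⟩⟩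
    rw [← h0]
    exact (ae_eq_refl _).inter Ioo_ae_eq_Icc
  rw [hset, measure_congr hae, Ici_inter_Iic, Real.volume_Icc, ← compl_Iio,
    ← probReal_compl_eq_one_sub measurableSet_Iio, ofReal_measureReal]

variable (hc : Continuous (cdf μ))
include hc

lemma cdf_le_iff_le_quantile (hu : u ∈ Ioo (0 : ℝ) 1) : cdf μ c ≤ u ↔ c ≤ quantile μ u := by
  rw [le_quantile_iff hu, measureReal_Iio_eq_leftLim_cdf,
    hc.continuousWithinAt.leftLim_eq]

lemma cdf_quantile (hu : u ∈ Ioo (0 : ℝ) 1) : cdf μ (quantile μ u) = u := by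
  refine le_antisymm ((cdf_le_iff_le_quantile hc hu).2 le_rfl) ?_
  obtain ⟨a, ha⟩ := ((tendsto_cdf_atBot μ).eventually (gt_mem_nhds hu.1)).exists
  obtain ⟨b, hb⟩ := nonempty_setOf_lt_cdf (μ := μ) hu.2
  obtain ⟨x, hx⟩ := mem_range_of_exists_le_of_exists_ge hc ⟨a, ha.le⟩ ⟨b, le_of_lt hb⟩
  rw [← hx]
  exact monotone_cdf μ (hx ▸ (cdf_le_iff_le_quantile hc hu).1 hx.le)

lemma setOf_cdf_le (hu : u ∈ Ioo (0 : ℝ) 1) : {x | cdf μ x ≤ u} = Iic (quantile μ u) :=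
  ext fun _ => cdf_le_iff_le_quantile hc hu

lemma map_cdf : μ.map (cdf μ) = volume.restrict (Ioo 0 1) := by
  have : IsProbabilityMeasure ((volume : Measure ℝ).restrict (Ioo 0 1)) := ⟨by simp⟩
  have := Measure.isProbabilityMeasure_map (μ := μ) hc.aemeasurable
  have hmid : ∀ u ∈ Ioo (0 : ℝ) 1, μ.map (cdf μ) (Iic u) = ENNReal.ofReal u := by
    intro u hu
    rw [Measure.map_apply hc.measurable measurableSet_Iic]
    change μ {x | cdf μ x ≤ u} = _
    rw [setOf_cdf_le hc hu, ← ofReal_cdf, cdf_quantile hc hu]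
  refine Measure.ext_of_Iic _ _ fun u => ?_
  rw [Measure.restrict_apply measurableSet_Iic]
  rcases le_or_gt u 0 with hu | hu
  · have h1 : (Iic u ∩ Ioo 0 1 : Set ℝ) = ∅ := by
      ext x
      simp only [mem_inter_iff, mem_Iic, mem_Ioo, mem_empty_iff_false, iff_false]
      intro h
      linarith [h.1, h.2.1]
    rw [h1, measure_empty]
    refine le_antisymm ?_ zero_le
    have hlim : Tendsto ENNReal.ofReal (𝓝[>] 0) (𝓝 0) := by
      simpa using (ENNReal.continuous_ofReal.tendsto 0).mono_left nhdsWithin_le_nhds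
    refine ge_of_tendsto hlim ?_
    filter_upwards [Ioo_mem_nhdsGT one_pos] with w hw
    rw [← hmid w hw]
    exact measure_mono (Iic_subset_Iic.2 (hu.trans hw.1.le))
  rcases lt_or_ge u 1 with hu' | hu'
  · rw [hmid u ⟨hu, hu'⟩]
    have h1 : (Iic u ∩ Ioo 0 1 : Set ℝ) = Ioc 0 u := by
      ext x
      simp only [mem_inter_iff, mem_Iic, mem_Ioo, mem_Ioc]
      exact ⟨fun h => ⟨h.2.1, h.1⟩, fun h => ⟨h.2, h.1, h.2.trans_lt hu'⟩⟩
    rw [h1, Real.volume_Ioc, sub_zero]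
  · have h1 : (Iic u ∩ Ioo 0 1 : Set ℝ) = Ioo 0 1 :=
      inter_eq_right.2 fun x hx => hx.2.le.trans hu'
    have h2 : cdf μ ⁻¹' Iic u = univ := eq_univ_of_forall fun x => (cdf_le_one μ x).trans hu'
    rw [h1, Measure.map_apply hc.measurable measurableSet_Iic, h2]
    simp

end Quantile

lemma measure_le_of_isLowerSet {μ ν : Measure ℝ} [NullSingletonClass ν]
    (h : ∀ u, μ (Iic u) ≤ ν (Iic u)) (huniv : μ univ ≤ ν univ) {s : Set ℝ} (hs : IsLowerSet s) :
    μ s ≤ ν s := by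
  rcases s.eq_empty_or_nonempty with rfl | hne
  · simp
  by_cases hb : BddAbove s
  · calc μ s ≤ μ (Iic (sSup s)) := measure_mono fun x hx => le_csSup hb hx
      _ ≤ ν (Iic (sSup s)) := h _
      _ = ν (Iio (sSup s)) := measure_congr Iio_ae_eq_Iic.symm
      _ ≤ ν s := measure_mono fun x hx => by
        obtain ⟨b, hbs, hxb⟩ := exists_lt_of_lt_csSup hne hx
        exact hs hxb.le hbs
  · have : s = univ := eq_univ_of_forall fun x => by
      obtain ⟨b, hbs, hxb⟩ := not_bddAbove_iff.1 hb x
      exact hs hxb.le hbs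
    rwa [this]

lemma lintegral_ofReal_le_of_antitoneOn {μ ν : Measure ℝ} [NullSingletonClass ν]
    (h : ∀ u, μ (Iic u) ≤ ν (Iic u)) (huniv : μ univ ≤ ν univ) {I : Set ℝ}
    (hI : MeasurableSet I) (hμ : ∀ᵐ x ∂μ, x ∈ I) (hν : ∀ᵐ x ∂ν, x ∈ I) {g : ℝ → ℝ}
    (hg : AntitoneOn g I) (hg0 : ∀ x, 0 ≤ g x) :
    ∫⁻ x, ENNReal.ofReal (g x) ∂μ ≤ ∫⁻ x, ENNReal.ofReal (g x) ∂ν := by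
  have key : ∀ (ρ : Measure ℝ), (∀ᵐ x ∂ρ, x ∈ I) → AEMeasurable g ρ := fun ρ hρ => by
    rw [← Measure.restrict_eq_self_of_ae_mem hρ]
    exact aemeasurable_restrict_of_antitoneOn hI hg
  rw [lintegral_eq_lintegral_meas_lt μ (ae_of_all _ hg0) (key μ hμ),
    lintegral_eq_lintegral_meas_lt ν (ae_of_all _ hg0) (key ν hν)]
  refine lintegral_mono fun t => ?_
  have hL : ∀ x ∈ I, x ∈ lowerClosure ({x | t < g x} ∩ I) ↔ t < g x := fun x hx => by
    refine ⟨?_, fun hx' => subset_lowerClosure ⟨hx', hx⟩⟩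
    rintro ⟨z, ⟨hz, hzI⟩, hxz⟩
    exact lt_of_lt_of_le hz (hg hx hzI hxz)
  have hset : ∀ (ρ : Measure ℝ), (∀ᵐ x ∂ρ, x ∈ I) →
      ρ {x | t < g x} = ρ (lowerClosure ({x | t < g x} ∩ I) : Set ℝ) := fun ρ hρ =>
    measure_congr (by
      filter_upwards [hρ] with x hx
      exact propext (hL x hx).symm)
  rw [hset μ hμ, hset ν hν]
  exact measure_le_of_isLowerSet h huniv (lowerClosure _).lower

lemma ENNReal.holderTriple_one_add_one_div (δ : ℝ≥0∞) :
    ENNReal.HolderTriple (1 + 1 / δ) (1 + δ) 1 := by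
  refine ⟨?_⟩
  rcases eq_or_ne δ 0 with rfl | h0
  · simp
  rcases eq_or_ne δ ∞ with rfl | h1
  · simp
  lift δ to NNReal using h1
  have h0' : δ ≠ 0 := by exact_mod_cast h0
  rw [one_div, ← ENNReal.coe_inv h0', ← ENNReal.coe_one, ← ENNReal.coe_add, ← ENNReal.coe_add,
    ← ENNReal.coe_inv (by positivity), ← ENNReal.coe_inv (by positivity),
    ← ENNReal.coe_inv one_ne_zero, ← ENNReal.coe_add]
  norm_cast
  field_simp
  ring

lemma lintegral_ofReal_mul_le_eLpNorm_mul_eLpNorm {α : Type*} {m : MeasurableSpace α}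
    {μ : Measure α} {f g : α → ℝ} (hf : AEStronglyMeasurable f μ) (hg : AEStronglyMeasurable g μ)
    (hf0 : ∀ x, 0 ≤ f x) (hg0 : ∀ x, 0 ≤ g x) (p q : ℝ≥0∞) [ENNReal.HolderTriple p q 1] :
    ∫⁻ x, ENNReal.ofReal (f x) * ENNReal.ofReal (g x) ∂μ ≤ eLpNorm f p μ * eLpNorm g q μ := by
  have h := eLpNorm_smul_le_mul_eLpNorm (p := p) (q := q) (r := 1) hg hf
  rw [eLpNorm_one_eq_lintegral_enorm] at h
  refine le_trans (lintegral_mono fun x => ?_) h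
  simp [enorm_mul, Real.enorm_of_nonneg (hf0 x), Real.enorm_of_nonneg (hg0 x)]

section Translation

variable {P : Measure ℝ} [IsProbabilityMeasure P] {y : ℝ} {φ : ℝ → ℝ}

lemma cdf_pos_of_quantile_translate_le (hc : Continuous (cdf P)) (hy : 0 < y)
    (hφint : IntegrableOn φ (Icc 0 1))
    (hφ : ∀ u ∈ Ioo (0 : ℝ) 1, cdf P (quantile P u + y) - u ≤ ∫ v in (0 : ℝ)..u, φ v) (x : ℝ) :
    0 < cdf P x := by
  by_contra! hx
  have hstep : ∀ z, cdf P z ≤ 0 → cdf P (z + y) ≤ 0 := by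
    intro z hz
    have hcont : ContinuousOn (fun u => u + ∫ v in (0 : ℝ)..u, φ v) (uIcc 0 1) :=
      continuousOn_id.add (intervalIntegral.continuousOn_primitive_interval
        (by rwa [uIcc_of_le zero_le_one]))
    have hlim : Tendsto (fun u => u + ∫ v in (0 : ℝ)..u, φ v) (𝓝[Ioo 0 1] 0) (𝓝 0) := by
      have := (hcont 0 left_mem_uIcc).mono
        (show Ioo (0 : ℝ) 1 ⊆ uIcc 0 1 from uIcc_of_le (zero_le_one' ℝ) ▸ Ioo_subset_Icc_self)
      simpa [ContinuousWithinAt] using this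
    have : (𝓝[Ioo (0 : ℝ) 1] 0).NeBot := left_nhdsWithin_Ioo_neBot one_pos
    refine ge_of_tendsto hlim ?_
    filter_upwards [self_mem_nhdsWithin] with u hu
    have hzu : z ≤ quantile P u := (cdf_le_iff_le_quantile hc hu).1 (hz.trans hu.1.le)
    have := monotone_cdf P (add_le_add_left hzu y)
    linarith [hφ u hu]
  have hn : ∀ n : ℕ, cdf P (x + n * y) ≤ 0 := by
    intro n
    induction n with
    | zero => simpa using hx
    | succ n ih =>
      have := hstep _ ih
      rwa [add_assoc, ← add_one_mul, ← Nat.cast_succ] at this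
  obtain ⟨b, hb⟩ := nonempty_setOf_lt_cdf (μ := P) one_pos
  obtain ⟨n, hn'⟩ := exists_nat_gt ((b - x) / y)
  rw [div_lt_iff₀ hy] at hn'
  exact (lt_of_lt_of_le hb (monotone_cdf P (by linarith))).not_ge (hn n)

lemma ae_cdf_mem_Ioo (hc : Continuous (cdf P)) : ∀ᵐ x ∂P, cdf P x ∈ Ioo (0 : ℝ) 1 := by
  have h : ∀ᵐ u ∂(P.map (cdf P)), u ∈ Ioo (0 : ℝ) 1 := by
    rw [map_cdf hc]
    exact ae_restrict_mem measurableSet_Ioo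
  exact ae_of_ae_map hc.aemeasurable h

lemma map_cdf_translate_Iic_le (hc : Continuous (cdf P)) (hpos : ∀ x, 0 < cdf P x)
    (hφ0 : ∀ v, 0 ≤ φ v) (hφint : IntegrableOn φ (Icc 0 1))
    (hφ : ∀ u ∈ Ioo (0 : ℝ) 1, cdf P (quantile P u + y) - u ≤ ∫ v in (0 : ℝ)..u, φ v) (u : ℝ) :
    P.map (fun x => cdf P (x - y)) (Iic u) ≤
      (volume.restrict (Ioo (0 : ℝ) 1) +
        (volume.restrict (Ioo (0 : ℝ) 1)).withDensity fun v => ENNReal.ofReal (φ v)) (Iic u) := by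
  have hm : Measurable fun x => cdf P (x - y) := (hc.comp (continuous_sub_right y)).measurable
  rw [Measure.map_apply hm measurableSet_Iic]
  rcases le_or_gt u 0 with hu | hu
  · have : (fun x => cdf P (x - y)) ⁻¹' Iic u = ∅ :=
      eq_empty_of_forall_notMem fun x hx => (hpos (x - y)).not_ge (le_trans hx hu)
    rw [this, measure_empty]
    exact zero_le
  rw [Measure.add_apply, withDensity_apply _ measurableSet_Iic,
    Measure.restrict_restrict measurableSet_Iic, Measure.restrict_apply measurableSet_Iic]
  rcases lt_or_ge u 1 with hu' | hu'
  · have hset : (Iic u ∩ Ioo 0 1 : Set ℝ) = Ioc 0 u := by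
      ext x
      simp only [mem_inter_iff, mem_Iic, mem_Ioo, mem_Ioc]
      exact ⟨fun h => ⟨h.2.1, h.1⟩, fun h => ⟨h.2, h.1, h.2.trans_lt hu'⟩⟩
    have hpre : (fun x => cdf P (x - y)) ⁻¹' Iic u = Iic (quantile P u + y) := by
      ext x
      simp only [mem_preimage, mem_Iic, cdf_le_iff_le_quantile hc ⟨hu, hu'⟩, sub_le_iff_le_add]
    have hint : IntegrableOn φ (Ioc 0 u) :=
      hφint.mono_set (Ioc_subset_Icc_self.trans (Icc_subset_Icc_right hu'.le))
    rw [hset, hpre, ← ofReal_cdf, Real.volume_Ioc, sub_zero,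
      ← ofReal_integral_eq_lintegral_ofReal hint (ae_of_all _ hφ0),
      ← ENNReal.ofReal_add hu.le (integral_nonneg hφ0), ← intervalIntegral.integral_of_le hu.le]
    exact ENNReal.ofReal_le_ofReal (by linarith [hφ u ⟨hu, hu'⟩])
  · have hset : (Iic u ∩ Ioo 0 1 : Set ℝ) = Ioo 0 1 :=
      inter_eq_right.2 fun x hx => hx.2.le.trans hu'
    rw [hset]
    refine prob_le_one.trans (le_trans ?_ le_self_add)
    simp

/-- Comparison for functions that are the sum of an antitone and a monotone part: the law of
`cdf P (X - y)` is dominated by the density `1 + φ` on the antitone part, and by the uniform law on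
the monotone part. -/
lemma lintegral_cdf_translate_le (hc : Continuous (cdf P)) (hy : 0 < y) (hφ0 : ∀ v, 0 ≤ φ v)
    (hφint : IntegrableOn φ (Icc 0 1))
    (hφ : ∀ u ∈ Ioo (0 : ℝ) 1, cdf P (quantile P u + y) - u ≤ ∫ v in (0 : ℝ)..u, φ v)
    {f g : ℝ → ℝ} (hf : AntitoneOn f (Ioo 0 1)) (hg : MonotoneOn g (Ioo 0 1))
    (hf0 : ∀ v, 0 ≤ f v) (hg0 : ∀ v, 0 ≤ g v) :
    ∫⁻ x, ENNReal.ofReal (f (cdf P (x - y)) + g (cdf P (x - y))) ∂P ≤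
      (∫⁻ v in Ioo 0 1, ENNReal.ofReal (f v + g v)) +
        ∫⁻ v in Ioo 0 1, ENNReal.ofReal (f v) * ENNReal.ofReal (φ v) := by
  have hpos := cdf_pos_of_quantile_translate_le hc hy hφint hφ
  have hm : Measurable fun x => cdf P (x - y) := (hc.comp (continuous_sub_right y)).measurable
  have hlt : ∀ x, cdf P (x - y) ≤ cdf P x := fun x => monotone_cdf P (by linarith)
  have hVmem : ∀ᵐ x ∂P, cdf P (x - y) ∈ Ioo (0 : ℝ) 1 := by
    filter_upwards [ae_cdf_mem_Ioo hc] with x hx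
    exact ⟨hpos _, (hlt x).trans_lt hx.2⟩
  set lam : Measure ℝ := volume.restrict (Ioo 0 1) with hlam
  set mu : Measure ℝ := P.map (fun x => cdf P (x - y)) with hmu
  have : IsProbabilityMeasure mu := Measure.isProbabilityMeasure_map hm.aemeasurable
  have hmuI : ∀ᵐ v ∂mu, v ∈ Ioo (0 : ℝ) 1 :=
    (ae_map_iff hm.aemeasurable measurableSet_Ioo).2 hVmem
  have hlamI : ∀ᵐ v ∂lam, v ∈ Ioo (0 : ℝ) 1 := ae_restrict_mem measurableSet_Ioo
  have hfmu : AEMeasurable f mu := by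
    rw [← Measure.restrict_eq_self_of_ae_mem hmuI]
    exact aemeasurable_restrict_of_antitoneOn measurableSet_Ioo hf
  have hflam : AEMeasurable f lam := aemeasurable_restrict_of_antitoneOn measurableSet_Ioo hf
  have hglam : AEMeasurable g lam := aemeasurable_restrict_of_monotoneOn measurableSet_Ioo hg
  have hφlam : AEMeasurable φ lam :=
    (hφint.mono_set Ioo_subset_Icc_self).aestronglyMeasurable.aemeasurable
  have hfV : AEMeasurable (fun x => ENNReal.ofReal (f (cdf P (x - y)))) P :=
    (hfmu.comp_measurable hm).ennreal_ofReal
  have hanti : ∫⁻ x, ENNReal.ofReal (f (cdf P (x - y))) ∂P ≤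
      (∫⁻ v, ENNReal.ofReal (f v) ∂lam) +
        ∫⁻ v, ENNReal.ofReal (f v) * ENNReal.ofReal (φ v) ∂lam := by
    set rho := lam.withDensity fun v => ENNReal.ofReal (φ v) with hrho
    have hac : rho ≪ lam := withDensity_absolutelyContinuous _ _
    have : NullSingletonClass (lam + rho) := ⟨fun x => by
      have h0 : lam {x} = 0 := measure_singleton x
      rw [Measure.add_apply, h0, hac h0, add_zero]⟩
    have h1 : ∫⁻ v, ENNReal.ofReal (f v) ∂mu ≤ ∫⁻ v, ENNReal.ofReal (f v) ∂(lam + rho) := by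
      refine lintegral_ofReal_le_of_antitoneOn
        (map_cdf_translate_Iic_le hc hpos hφ0 hφint hφ) ?_ measurableSet_Ioo hmuI ?_ hf hf0
      · rw [measure_univ, Measure.add_apply]
        refine le_trans ?_ le_self_add
        simp
      · exact ae_add_measure_iff.2 ⟨hlamI, hac.ae_le hlamI⟩
    rw [lintegral_add_measure, hmu, lintegral_map' hfmu.ennreal_ofReal hm.aemeasurable, hrho,
      lintegral_withDensity_eq_lintegral_mul₀ hφlam.ennreal_ofReal hflam.ennreal_ofReal] at h1
    simpa only [Pi.mul_apply, mul_comm] using h1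
  have hmono : ∫⁻ x, ENNReal.ofReal (g (cdf P (x - y))) ∂P ≤ ∫⁻ v, ENNReal.ofReal (g v) ∂lam := by
    rw [hlam, ← map_cdf hc, lintegral_map' (by rw [map_cdf hc]; exact hglam.ennreal_ofReal)
      hc.aemeasurable]
    refine lintegral_mono_ae ?_
    filter_upwards [ae_cdf_mem_Ioo hc, hVmem] with x hx hV
    exact ENNReal.ofReal_le_ofReal (hg hV hx (hlt x))
  simp_rw [ENNReal.ofReal_add (hf0 _) (hg0 _)]
  rw [lintegral_add_left' hfV, lintegral_add_left' hflam.ennreal_ofReal, add_right_comm]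
  exact add_le_add hanti hmono

end Translation

lemma Real.abs_rpow_eq_neg_part_add_pos_part (t : ℝ) {q : ℝ} (hq : q ≠ 0) :
    |t| ^ q = (max (-t) 0) ^ q + (max t 0) ^ q := by
  rcases le_total t 0 with ht | ht
  · rw [max_eq_left (neg_nonneg.2 ht), max_eq_right ht, abs_of_nonpos ht, Real.zero_rpow hq,
      add_zero]
  · rw [max_eq_right (neg_nonpos.2 ht), max_eq_left ht, abs_of_nonneg ht, Real.zero_rpow hq,
      zero_add]

/-- bound on `∫ |T(x-y)|^q P(dx)` for the translated optimal transport map,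
in terms of `E[|X̃|^q]` and the Hölder product `‖|X̃|^q‖_{1+1/δ} ‖φ_y(U)‖_{1+δ}`
(both sides may be infinite). -/
theorem stmt3 (P Pt : Measure ℝ) [IsProbabilityMeasure P] [IsProbabilityMeasure Pt]
    (F Ft : ℝ → ℝ)
    (hF : ∀ x, F x = (P (Iic x)).toReal) (hFt : ∀ x, Ft x = (Pt (Iic x)).toReal)
    (hFc : Continuous F)
    (Finv Ftinv : ℝ → ℝ)
    (hFinv : ∀ u, Finv u = sInf {x : ℝ | u < F x})
    (hFtinv : ∀ u, Ftinv u = sInf {x : ℝ | u < Ft x})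
    (T : ℝ → ℝ) (hT : ∀ x, T x = Ftinv (F x))
    (y : ℝ) (hy : 0 < y)
    (φ : ℝ → ℝ) (hφpos : ∀ v, 0 ≤ φ v)
    (hφint : IntegrableOn φ (Icc 0 1) volume)
    (hφcond : ∀ u ∈ Ioo (0:ℝ) 1, F (Finv u + y) - u ≤ ∫ v in (0:ℝ)..u, φ v)
    (q : ℝ) (hq : 0 < q) (δ : ℝ≥0∞) :
    ∫⁻ x, ENNReal.ofReal (|T (x - y)| ^ q) ∂P
      ≤ (∫⁻ z, ENNReal.ofReal (|z| ^ q) ∂Pt)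
        + eLpNorm (fun z => |z| ^ q) (1 + 1/δ) Pt *
            eLpNorm φ (1 + δ) (volume.restrict (Icc (0:ℝ) 1)) := by
  obtain rfl : F = cdf P := funext fun x => (hF x).trans (cdf_eq_real P x).symm
  obtain rfl : Ft = cdf Pt := funext fun x => (hFt x).trans (cdf_eq_real Pt x).symm
  obtain rfl : Finv = quantile P := funext hFinv
  obtain rfl : Ftinv = quantile Pt := funext hFtinv
  have hmono := monotoneOn_quantile (μ := Pt)
  have hQ := aemeasurable_quantile (μ := Pt)
  have hmeas : Measurable fun z : ℝ => |z| ^ q := by fun_prop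
  have hL := lintegral_cdf_translate_le hFc hy hφpos hφint hφcond
    (f := fun u => (max (-quantile Pt u) 0) ^ q) (g := fun u => (max (quantile Pt u) 0) ^ q)
    (fun u hu v hv huv => Real.rpow_le_rpow (le_max_right _ _)
      (max_le_max_right 0 (neg_le_neg (hmono hu hv huv))) hq.le)
    (fun u hu v hv huv => Real.rpow_le_rpow (le_max_right _ _)
      (max_le_max_right 0 (hmono hu hv huv)) hq.le)
    (fun _ => Real.rpow_nonneg (le_max_right _ _) _)
    (fun _ => Real.rpow_nonneg (le_max_right _ _) _)
  simp_rw [← Real.abs_rpow_eq_neg_part_add_pos_part _ hq.ne', ← hT] at hL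
  have hmean : ∫⁻ z, ENNReal.ofReal (|z| ^ q) ∂Pt =
      ∫⁻ v in Ioo 0 1, ENNReal.ofReal (|quantile Pt v| ^ q) := by
    conv_lhs => rw [← map_quantile (μ := Pt)]
    exact lintegral_map' hmeas.ennreal_ofReal.aemeasurable hQ
  have hnorm : eLpNorm (fun z => |z| ^ q) (1 + 1 / δ) Pt =
      eLpNorm (fun v => |quantile Pt v| ^ q) (1 + 1 / δ) (volume.restrict (Ioo 0 1)) := by
    conv_lhs => rw [← map_quantile (μ := Pt)]
    exact eLpNorm_map_measure hmeas.aestronglyMeasurable hQ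
  have := ENNReal.holderTriple_one_add_one_div δ
  rw [hmean, hnorm, ← Measure.restrict_congr_set (Ioo_ae_eq_Icc (a := (0 : ℝ)) (b := 1))]
  refine hL.trans (add_le_add le_rfl (le_trans (lintegral_mono fun v => ?_)
    (lintegral_ofReal_mul_le_eLpNorm_mul_eLpNorm
      (f := fun v => |quantile Pt v| ^ q) (hmeas.comp_aemeasurable hQ).aestronglyMeasurable
      (hφint.mono_set Ioo_subset_Icc_self).aestronglyMeasurable
      (fun _ => Real.rpow_nonneg (abs_nonneg _) _) hφpos _ _)))
  exact mul_le_mul' (ENNReal.ofReal_le_ofReal (Real.rpow_le_rpow (le_max_right _ _)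
    (max_le (neg_le_abs _) (abs_nonneg _)) hq.le)) le_rfl
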